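/- (Example 4.2, sampled-data linear feedback step) Fix n ≥ 1, let A ∈ ℝ^{n×n} be the matrix with A_{i,j} = 1 if j = i−1 and 0 otherwise and b = (1,0,…,0)' ∈ ℝⁿ. Let D ⊂ ℝˡ be nonempty compact and f : D×ℝⁿ → ℝⁿ locally Lipschitz with f(d,0) = 0, and suppose |f(d,x)| ≤ L₂|x| for all (d,x) with some L₂ > 0. Let P be symmetric positive definite, p ∈ ℝⁿ, q > 0 with x'P(A+bp')x + x'Pf(d,x) ≤ −q|x|² for all (d,x) ∈ D×ℝⁿ. Then there exist r > 0 and q̃ > 0 such that: for every sampling schedule with MASP r, every measurable d : [0,∞) → D, and every locally absolutely continuous x : [0,∞) → ℝⁿ satisfying ẋ(t) = Ax(t) + b·(p'x(τ_i)) + f(d(t),x(t)) for almost every t ∈ [τ_i, τ_{i+1}) and each i, the function V(t) = x(t)'Px(t) satisfies V̇(t) ≤ −q̃|x(t)|² for almost every t ≥ 0. -/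

import Mathlib

open Matrix MeasureTheory Set Filter

noncomputable section

/-- The `m × m` matrix with ones on the subdiagonal and zeros elsewhere. -/
def matA (m : ℕ) : Matrix (Fin m) (Fin m) ℝ :=
  Matrix.of fun i j => if (i : ℕ) = (j : ℕ) + 1 then 1 else 0

/-- The vector `b = (1,0,…,0)'` as a plain function. -/
def vecbf (m : ℕ) : Fin m → ℝ := fun i => if (i : ℕ) = 0 then 1 else 0

/-- The vector `b = (1,0,…,0)'` in Euclidean space. -/
def vecb (m : ℕ) : EuclideanSpace ℝ (Fin m) := (WithLp.equiv 2 (Fin m → ℝ)).symm (vecbf m)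

/-- View a Euclidean vector as a plain function. -/
def ef {m : ℕ} (x : EuclideanSpace ℝ (Fin m)) : Fin m → ℝ := x

/-- Matrix-vector multiplication on Euclidean space. -/
def mulVecE {m : ℕ} (M : Matrix (Fin m) (Fin m) ℝ) (x : EuclideanSpace ℝ (Fin m)) :
    EuclideanSpace ℝ (Fin m) :=
  (WithLp.equiv 2 (Fin m → ℝ)).symm (M.mulVec (ef x))

/-- Euclidean inner product `x'y`. -/
def ip {m : ℕ} (x y : EuclideanSpace ℝ (Fin m)) : ℝ := ∑ i, x i * y i

/-- Quadratic form `x'Px`. -/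
def qf {m : ℕ} (P : Matrix (Fin m) (Fin m) ℝ) (x : EuclideanSpace ℝ (Fin m)) : ℝ :=
  ip x (mulVecE P x)

/-- The saturation function `sat(s) = s / max(1,|s|)`. -/
def sat (s : ℝ) : ℝ := s / max 1 |s|

/-- The vector `c = -(A' + pb')⁻¹ (0,…,0,1)'`. -/
def cvec (n : ℕ) (p : EuclideanSpace ℝ (Fin (n+1))) : EuclideanSpace ℝ (Fin (n+1)) :=
  (WithLp.equiv 2 (Fin (n+1) → ℝ)).symm
    (-((((matA (n+1))ᵀ + vecMulVec (ef p) (vecbf (n+1)))⁻¹).mulVec (Pi.single (Fin.last n) 1)))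

/-- Condition (3.3): `x'P(Ax + f(d,x,u) + bu) < 0` whenever `d ∈ D`, `x'Px = R²` and
`|u - p'x| ≤ K|c'b|`. -/
def Cond33 {l n : ℕ} (D : Set (EuclideanSpace ℝ (Fin l)))
    (f : EuclideanSpace ℝ (Fin l) → EuclideanSpace ℝ (Fin (n+1)) → ℝ → EuclideanSpace ℝ (Fin (n+1)))
    (P : Matrix (Fin (n+1)) (Fin (n+1)) ℝ) (p : EuclideanSpace ℝ (Fin (n+1))) (R K : ℝ) : Prop :=
  ∀ d ∈ D, ∀ x : EuclideanSpace ℝ (Fin (n+1)), ∀ u : ℝ,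
    qf P x = R ^ 2 → |u - ip p x| ≤ K * |ip (cvec n p) (vecb (n+1))| →
      ip x (mulVecE P (mulVecE (matA (n+1)) x + f d x u + u • vecb (n+1))) < 0

/-- Condition (3.4): `|g(d,x,u) + c'f(d,x,u)| < K(c'b)²` whenever `d ∈ D`, `x'Px ≤ R²` and
`|u - p'x| ≤ K|c'b|`. -/
def Cond34 {l n : ℕ} (D : Set (EuclideanSpace ℝ (Fin l)))
    (f : EuclideanSpace ℝ (Fin l) → EuclideanSpace ℝ (Fin (n+1)) → ℝ → EuclideanSpace ℝ (Fin (n+1)))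
    (g : EuclideanSpace ℝ (Fin l) → EuclideanSpace ℝ (Fin (n+1)) → ℝ → ℝ)
    (P : Matrix (Fin (n+1)) (Fin (n+1)) ℝ) (p : EuclideanSpace ℝ (Fin (n+1))) (R K : ℝ) : Prop :=
  ∀ d ∈ D, ∀ x : EuclideanSpace ℝ (Fin (n+1)), ∀ u : ℝ,
    qf P x ≤ R ^ 2 → |u - ip p x| ≤ K * |ip (cvec n p) (vecb (n+1))| →
      |g d x u + ip (cvec n p) (f d x u)| < K * (ip (cvec n p) (vecb (n+1))) ^ 2

/-- Condition (3.5). -/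
def Cond35 {l n : ℕ} (D : Set (EuclideanSpace ℝ (Fin l)))
    (f : EuclideanSpace ℝ (Fin l) → EuclideanSpace ℝ (Fin (n+1)) → ℝ → EuclideanSpace ℝ (Fin (n+1)))
    (g : EuclideanSpace ℝ (Fin l) → EuclideanSpace ℝ (Fin (n+1)) → ℝ → ℝ)
    (P : Matrix (Fin (n+1)) (Fin (n+1)) ℝ) (p : EuclideanSpace ℝ (Fin (n+1)))
    (M R K ω δ : ℝ) : Prop :=
  ∀ d ∈ D, ∀ x : EuclideanSpace ℝ (Fin (n+1)), ∀ z : ℝ,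
    qf P x ≤ R ^ 2 → ω * |z| ≤ 1 →
      ∀ u : ℝ, u = ip p x - K * ip (cvec n p) (vecb (n+1)) * ω * z →
        z * (M * g d x u + M * ip (cvec n p) (f d x u)
              - K * ip (cvec n p) (vecb (n+1)) * ω * ip (vecb (n+1)) (mulVecE P x))
          ≤ (M * K * (ip (cvec n p) (vecb (n+1))) ^ 2 * ω - δ) * z ^ 2
            - ip x (mulVecE P
                (mulVecE (matA (n+1) + vecMulVec (vecbf (n+1)) (ef p) + δ • 1) x + f d x u))

/-- A sampling schedule with maximum allowable sampling period `r`. -/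
def Sched (r : ℝ) (τ : ℕ → ℝ) : Prop :=
  τ 0 = 0 ∧ (∀ i, 0 < τ (i+1) - τ i) ∧ (∀ i, τ (i+1) - τ i ≤ r) ∧
    Tendsto τ atTop atTop

/-- A (locally absolutely continuous) solution of the sampled-data system
`ẋ = Ax + b(p'x(τᵢ)) + f(d,x)` with zero-order-hold linear feedback. -/
def SolXLin {l n : ℕ}
    (f : EuclideanSpace ℝ (Fin l) → EuclideanSpace ℝ (Fin (n+1)) → EuclideanSpace ℝ (Fin (n+1)))
    (p : EuclideanSpace ℝ (Fin (n+1))) (τ : ℕ → ℝ)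
    (d : ℝ → EuclideanSpace ℝ (Fin l))
    (x : ℝ → EuclideanSpace ℝ (Fin (n+1))) : Prop :=
  ∃ x' : ℝ → EuclideanSpace ℝ (Fin (n+1)),
    (∀ T : ℝ, IntervalIntegrable x' volume 0 T) ∧
    (∀ t : ℝ, 0 ≤ t → x t = x 0 + ∫ s in (0:ℝ)..t, x' s) ∧
    ∀ i : ℕ, ∀ᵐ t ∂(volume.restrict (Ico (τ i) (τ (i+1)))),
      x' t = mulVecE (matA (n+1)) (x t) + ip p (x (τ i)) • vecb (n+1) + f (d t) (x t)

lemma ip_eq_inner {m : ℕ} (x y : EuclideanSpace ℝ (Fin m)) : ip x y = inner ℝ x y := by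
  simp [ip, PiLp.inner_apply, mul_comm]

lemma mulVecE_eq_toEuclideanCLM {m : ℕ} (M : Matrix (Fin m) (Fin m) ℝ)
    (x : EuclideanSpace ℝ (Fin m)) :
    mulVecE M x = toEuclideanCLM (n := Fin m) (𝕜 := ℝ) M x := rfl

lemma mulVecE_add_vecMulVec {m : ℕ} (M : Matrix (Fin m) (Fin m) ℝ)
    (p x : EuclideanSpace ℝ (Fin m)) :
    mulVecE (M + vecMulVec (vecbf m) (ef p)) x = mulVecE M x + ip p x • vecb m := by
  ext i
  simp [mulVecE, vecb, ip, ef, add_mulVec, vecMulVec_mulVec, dotProduct, mul_comm]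

/-- Symmetry of the operator of a symmetric real matrix with respect to the inner product. -/
lemma inner_toEuclideanCLM_comm {m : ℕ} {M : Matrix (Fin m) (Fin m) ℝ} (hM : M.IsHermitian)
    (x y : EuclideanSpace ℝ (Fin m)) :
    inner ℝ x (toEuclideanCLM (n := Fin m) (𝕜 := ℝ) M y)
      = inner ℝ y (toEuclideanCLM (n := Fin m) (𝕜 := ℝ) M x) := by
  have h : ContinuousLinearMap.adjoint (toEuclideanCLM (n := Fin m) (𝕜 := ℝ) M)
      = toEuclideanCLM (n := Fin m) (𝕜 := ℝ) M := by
    rw [← ContinuousLinearMap.star_eq_adjoint, ← map_star, star_eq_conjTranspose, hM.eq]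
  rw [← ContinuousLinearMap.adjoint_inner_left, h, real_inner_comm]

/-- Over a short interval, a curve whose velocity is bounded by its own size and its initial size
stays close to its initial point, relative to its final size. -/
lemma norm_sub_le_of_norm_deriv_le {E : Type*} [NormedAddCommGroup E] [NormedSpace ℝ E]
    {x x' : ℝ → E} {a t r K : ℝ} (hat : a ≤ t) (htr : t - a ≤ r) (hK : 0 ≤ K)
    (hrK : 6 * (r * K) ≤ 1) (hint : IntervalIntegrable x' volume a t)
    (hx : ∀ s ∈ Icc a t, x s = x a + ∫ u in a..s, x' u)
    (hbound : ∀ᵐ s, s ∈ Icc a t → ‖x' s‖ ≤ K * (‖x s‖ + ‖x a‖)) :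
    ‖x t - x a‖ ≤ 4 * (r * K) * ‖x t‖ := by
  have hsub : ∀ s ∈ Icc a t, x s - x a = ∫ u in a..s, x' u := fun s hs => by simp [hx s hs]
  have hcont : ContinuousOn (fun s => ‖x s - x a‖) (Icc a t) := by
    have := intervalIntegral.continuousOn_primitive_interval' hint left_mem_uIcc
    rw [uIcc_of_le hat] at this
    exact (this.congr hsub).norm
  obtain ⟨s, hs, hmax⟩ := isCompact_Icc.exists_isMaxOn (nonempty_Icc.2 hat) hcont
  have hmax' : ∀ u ∈ Icc a t, ‖x u - x a‖ ≤ ‖x s - x a‖ := fun u hu => hmax hu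
  set M := ‖x s - x a‖ with hM
  have hMt : ‖x t - x a‖ ≤ M := hmax' t ⟨hat, le_rfl⟩
  have ha : ‖x a‖ ≤ ‖x t‖ + M := by
    have := norm_sub_norm_le (x a) (x t)
    rw [norm_sub_rev] at this
    linarith
  have hMle : M ≤ K * (2 * ‖x t‖ + 3 * M) * |s - a| := by
    have hMs : M = ‖∫ u in a..s, x' u‖ := congrArg norm (hsub s hs)
    refine hMs.trans_le ?_
    apply intervalIntegral.norm_integral_le_of_norm_le_const_ae
    filter_upwards [hbound] with u hu hus
    rw [uIoc_of_le hs.1] at hus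
    have hut : u ∈ Icc a t := ⟨hus.1.le, hus.2.trans hs.2⟩
    refine (hu hut).trans (mul_le_mul_of_nonneg_left ?_ hK)
    have h1 := norm_sub_norm_le (x u) (x a)
    have h2 := hmax' u hut
    linarith
  rw [abs_of_nonneg (sub_nonneg.2 hs.1)] at hMle
  have hM0 : 0 ≤ M := norm_nonneg _
  have h1 : K * (2 * ‖x t‖ + 3 * M) * (s - a) ≤ K * (2 * ‖x t‖ + 3 * M) * r :=
    mul_le_mul_of_nonneg_left (by linarith [hs.2]) (by positivity)
  nlinarith [mul_le_mul_of_nonneg_right hrK hM0]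

lemma Sched.exists_mem_Ico {r : ℝ} {τ : ℕ → ℝ} (h : Sched r τ) {t : ℝ} (ht : 0 ≤ t) :
    ∃ i, t ∈ Ico (τ i) (τ (i + 1)) := by
  obtain ⟨h0, -, -, hlim⟩ := h
  have hex : ∃ i, t < τ i := (hlim.eventually_gt_atTop t).exists
  classical
  obtain ⟨j, hj⟩ : ∃ j, Nat.find hex = j + 1 := Nat.exists_eq_succ_of_ne_zero fun h => by
    have := Nat.find_spec hex
    rw [h, h0] at this
    linarith
  exact ⟨j, not_lt.1 (Nat.find_min hex (by omega)), hj ▸ Nat.find_spec hex⟩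

lemma Sched.nonneg {r : ℝ} {τ : ℕ → ℝ} (h : Sched r τ) (i : ℕ) : 0 ≤ τ i :=
  h.1 ▸ (monotone_nat_of_le_succ fun j => (sub_pos.1 (h.2.1 j)).le) (Nat.zero_le i)

/-- **Example 4.2 (sampled-data linear feedback step).** Under the linear growth bound and
the Lyapunov condition `x'P(A+bp')x + x'Pf(d,x) ≤ -q|x|²`, there exist `r > 0` and
`q̃ > 0` such that along any closed-loop solution with MASP `r`, the function
`V(t) = x(t)'Px(t)` satisfies `V̇(t) ≤ -q̃|x(t)|²` for almost every `t ≥ 0`. -/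
theorem example_4_2_linear_step (n l : ℕ)
    (D : Set (EuclideanSpace ℝ (Fin l))) (hD : D.Nonempty) (hDc : IsCompact D)
    (f : EuclideanSpace ℝ (Fin l) → EuclideanSpace ℝ (Fin (n+1)) → EuclideanSpace ℝ (Fin (n+1)))
    (hfLip : LocallyLipschitz
      (fun q : EuclideanSpace ℝ (Fin l) × EuclideanSpace ℝ (Fin (n+1)) => f q.1 q.2))
    (hf0 : ∀ d ∈ D, f d 0 = 0)
    (L2 : ℝ) (hL2 : 0 < L2)
    (hglob : ∀ d ∈ D, ∀ x : EuclideanSpace ℝ (Fin (n+1)), ‖f d x‖ ≤ L2 * ‖x‖)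
    (P : Matrix (Fin (n+1)) (Fin (n+1)) ℝ) (hP : P.PosDef)
    (p : EuclideanSpace ℝ (Fin (n+1))) (q : ℝ) (hq : 0 < q)
    (hLyap : ∀ d ∈ D, ∀ x : EuclideanSpace ℝ (Fin (n+1)),
      ip x (mulVecE P (mulVecE (matA (n+1) + vecMulVec (vecbf (n+1)) (ef p)) x))
          + ip x (mulVecE P (f d x)) ≤ -q * ‖x‖ ^ 2) :
    ∃ r : ℝ, 0 < r ∧ ∃ qt : ℝ, 0 < qt ∧
      ∀ (τ : ℕ → ℝ) (d : ℝ → EuclideanSpace ℝ (Fin l))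
        (x : ℝ → EuclideanSpace ℝ (Fin (n+1))),
        Sched r τ → Measurable d → (∀ t : ℝ, d t ∈ D) →
        SolXLin f p τ d x →
        ∀ᵐ t ∂(volume.restrict (Ici (0:ℝ))), ∀ v : ℝ,
          HasDerivAt (fun s => qf P (x s)) v t → v ≤ -qt * ‖x t‖ ^ 2 := by
  set A := toEuclideanCLM (n := Fin (n + 1)) (𝕜 := ℝ) (matA (n + 1))
  set Q := toEuclideanCLM (n := Fin (n + 1)) (𝕜 := ℝ) P
  set b := vecb (n + 1)
  have hlyap : ∀ d ∈ D, ∀ x : EuclideanSpace ℝ (Fin (n + 1)),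
      inner ℝ x (Q (A x + (inner ℝ p x : ℝ) • b + f d x)) ≤ -q * ‖x‖ ^ 2 := by
    intro d hd x
    have := hLyap d hd x
    rwa [mulVecE_add_vecMulVec, ip_eq_inner, ip_eq_inner, ip_eq_inner, ← inner_add_right,
      mulVecE_eq_toEuclideanCLM P, mulVecE_eq_toEuclideanCLM P, ← map_add] at this
  set K := ‖A‖ + L2 + ‖p‖ * ‖b‖ with hK
  set B := ‖Q‖ * ‖b‖ * ‖p‖ with hB
  have hK0 : 0 < K := by positivity
  have hB0 : 0 ≤ B := by positivity
  set r := 1 / (K * (6 + 8 * B / q)) with hr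
  have hr0 : 0 < r := by positivity
  have hrK : r * K * (6 + 8 * B / q) = 1 := by
    rw [hr]; field_simp
  have hrK0 : 0 < r * K := by positivity
  have hrK6 : 6 * (r * K) ≤ 1 := by
    have : 0 ≤ r * K * (8 * B / q) := by positivity
    linarith
  have hrKB : 8 * B * (r * K) ≤ q := by
    have h1 : r * K * (8 * B / q) ≤ 1 := by linarith
    have h2 : 8 * B * (r * K) = r * K * (8 * B / q) * q := by field_simp
    rw [h2]
    nlinarith
  refine ⟨r, hr0, q, hq, ?_⟩
  rintro τ d x hτ - hd ⟨x', hint, hx, hode⟩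
  have hint' : ∀ s t : ℝ, IntervalIntegrable x' volume s t :=
    fun s t => (hint s).symm.trans (hint t)
  have hloc : LocallyIntegrable x' volume := by
    rw [MeasureTheory.locallyIntegrable_iff]
    intro k hk
    obtain ⟨R, hR⟩ := hk.isBounded.subset_closedBall 0
    rw [Real.closedBall_eq_Icc] at hR
    by_cases h : 0 - R ≤ 0 + R
    · exact ((intervalIntegrable_iff_integrableOn_Icc_of_le h).1 (hint' _ _)).mono_set hR
    · rw [Icc_eq_empty h] at hR
      exact integrableOn_empty.mono_set hR
  have hode' : ∀ᵐ t, ∀ i, t ∈ Ico (τ i) (τ (i + 1)) →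
      x' t = A (x t) + (inner ℝ p (x (τ i)) : ℝ) • b + f (d t) (x t) := by
    rw [ae_all_iff]
    intro i
    have := (ae_restrict_iff' measurableSet_Ico).1 (hode i)
    simpa only [mulVecE_eq_toEuclideanCLM, ip_eq_inner] using this
  rw [ae_restrict_iff' measurableSet_Ici]
  filter_upwards [hode', LocallyIntegrable.ae_hasDerivAt_integral hloc, Measure.ae_ne volume (0 : ℝ)]
    with t htode htderiv ht0 ht v hv
  obtain ⟨i, hi⟩ := hτ.exists_mem_Ico ht
  have hτi := hτ.nonneg i
  have hdev : ‖x t - x (τ i)‖ ≤ 4 * (r * K) * ‖x t‖ := by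
    refine norm_sub_le_of_norm_deriv_le hi.1 ?_ hK0.le hrK6 (hint' _ _) ?_ ?_
    · linarith [hi.2, hτ.2.2.1 i]
    · intro s hs
      rw [hx s (hτi.trans hs.1), hx _ hτi, add_assoc,
        intervalIntegral.integral_add_adjacent_intervals (hint' _ _) (hint' _ _)]
    · filter_upwards [hode'] with s hsode hs
      rw [hsode i ⟨hs.1, hs.2.trans_lt hi.2⟩]
      have h1 := norm_add₃_le (a := A (x s)) (b := (inner ℝ p (x (τ i)) : ℝ) • b)
        (c := f (d s) (x s))
      have h2 := A.le_opNorm (x s)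
      have h3 : ‖(inner ℝ p (x (τ i)) : ℝ) • b‖ ≤ ‖p‖ * ‖x (τ i)‖ * ‖b‖ := by
        rw [norm_smul]
        exact mul_le_mul_of_nonneg_right (norm_inner_le_norm _ _) (norm_nonneg _)
      have h4 := hglob (d s) (hd s) (x s)
      have h5 : 0 ≤ (‖A‖ + L2) * ‖x (τ i)‖ := by positivity
      have h6 : 0 ≤ ‖p‖ * ‖b‖ * ‖x s‖ := by positivity
      rw [hK]
      linarith
  have hxd : HasDerivAt x (x' t) t := by
    refine ((htderiv 0).const_add (x 0)).congr_of_eventuallyEq ?_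
    filter_upwards [Ioi_mem_nhds (lt_of_le_of_ne ht ht0.symm)] with s hs
    exact hx s (le_of_lt hs)
  have hVd : HasDerivAt (fun s => qf P (x s)) (2 * inner ℝ (x t) (Q (x' t))) t := by
    have h := hxd.inner ℝ (Q.hasFDerivAt.comp_hasDerivAt t hxd)
    rw [Function.comp_apply, inner_toEuclideanCLM_comm hP.isHermitian (x' t) (x t),
      ← two_mul] at h
    refine h.congr_of_eventuallyEq (Eventually.of_forall fun s => ?_)
    exact ip_eq_inner _ _
  rw [hv.unique hVd, htode i hi]
  have hsplit : A (x t) + (inner ℝ p (x (τ i)) : ℝ) • b + f (d t) (x t)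
      = (A (x t) + (inner ℝ p (x t) : ℝ) • b + f (d t) (x t))
        - (inner ℝ p (x t - x (τ i)) : ℝ) • b := by
    rw [inner_sub_right, sub_smul]; abel
  rw [hsplit, map_sub, inner_sub_right]
  have hmain := hlyap (d t) (hd t) (x t)
  have herr : |inner ℝ (x t) (Q ((inner ℝ p (x t - x (τ i)) : ℝ) • b))|
      ≤ B * (4 * (r * K)) * ‖x t‖ ^ 2 := calc
    _ ≤ ‖x t‖ * (‖Q‖ * ((‖p‖ * ‖x t - x (τ i)‖) * ‖b‖)) := by
      refine (abs_real_inner_le_norm _ _).trans ?_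
      gcongr
      refine Q.le_opNorm_of_le ?_
      rw [norm_smul]
      gcongr
      exact norm_inner_le_norm _ _
    _ ≤ ‖x t‖ * (‖Q‖ * ((‖p‖ * (4 * (r * K) * ‖x t‖)) * ‖b‖)) := by gcongr
    _ = _ := by rw [hB]; ring
  have hneg := neg_le_of_abs_le herr
  nlinarith [mul_le_mul_of_nonneg_right hrKB (sq_nonneg ‖x t‖)]
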